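/- Let r ∈ ℝ, α ≥ 0, and let z : [0, ∞) → ℝ be continuous. Let p : [0, ∞) → ℝ be differentiable with p(0) = p₀ ∈ (0, 1) and p'(t) = (r + α z(t)) p(t)(1 - p(t)) for all t ≥ 0. Then p(t) ∈ (0,1) for all t ≥ 0 and, for every t > 0, the estimator r̂(t) = (1/t) log( p(t)(1 - p₀) / (p₀ (1 - p(t))) ) satisfies r̂(t) = r + (α/t) ∫₀ᵗ z(s) ds. In particular, if (1/t) ∫₀ᵗ z(s) ds → 0 as t → ∞, then r̂(t) → r. -/

import Mathlib

open Filter intervalIntegral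

/-- Solutions of the scalar linear equation `u' = a u` on `[0, ∞)`. -/
lemma linear_ode_solution (a u : ℝ → ℝ) (ha : ContinuousOn a (Set.Ici (0 : ℝ)))
    (hu : ∀ t ∈ Set.Ici (0 : ℝ), HasDerivWithinAt u (a t * u t) (Set.Ici (0 : ℝ)) t)
    (t : ℝ) (ht : 0 ≤ t) : u t = u 0 * Real.exp (∫ s in (0 : ℝ)..t, a s) := by
  have hb : Continuous (fun s => a (max s 0)) :=
    ha.comp_continuous (by fun_prop) (fun s => le_max_right s 0)
  have hG : ∀ x, HasDerivAt (fun x => ∫ s in (0 : ℝ)..x, a (max s 0)) (a (max x 0)) x :=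
    fun x => integral_hasDerivAt_right (hb.intervalIntegrable _ _)
      (hb.stronglyMeasurableAtFilter _ _) hb.continuousAt
  have hf : ∀ x ∈ Set.Ici (0 : ℝ), HasDerivWithinAt
      (fun x => u x * Real.exp (-∫ s in (0 : ℝ)..x, a (max s 0))) 0 (Set.Ici (0 : ℝ)) x := by
    intro x hx
    have h := (hu x hx).mul ((hG x).neg.exp.hasDerivWithinAt (s := Set.Ici (0 : ℝ)))
    refine h.congr_deriv ?_
    simp only [Set.mem_Ici] at hx
    simp only [max_eq_left hx, Pi.neg_apply]
    ring
  have hc := constant_of_has_deriv_right_zero (a := 0) (b := t)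
    (fun x hx => ((hf x hx.1).continuousWithinAt).mono Set.Icc_subset_Ici_self)
    (fun x hx => (hf x hx.1).mono (Set.Ici_subset_Ici.2 hx.1)) t ⟨ht, le_rfl⟩
  have hI : ∫ s in (0 : ℝ)..t, a (max s 0) = ∫ s in (0 : ℝ)..t, a s := by
    refine integral_congr (fun s hs => ?_)
    rw [Set.uIcc_of_le ht] at hs
    simp only [max_eq_left hs.1]
  simp only [hI, integral_same, neg_zero, Real.exp_zero, mul_one] at hc
  rw [← hc, mul_assoc, ← Real.exp_add]
  simp

/-- For the randomly perturbed logistic equation `p' = (r + α z(t)) p (1 - p)` with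
`p₀ ∈ (0, 1)`, the estimator `r̂(t) = (1/t) log( p(t)(1 - p₀) / (p₀ (1 - p(t))) )` satisfies
`r̂(t) = r + (α/t) ∫₀ᵗ z`, and converges to `r` whenever the time average of `z` tends to 0. -/
theorem logistic_growth_rate_estimator_perturbed (r α : ℝ) (hα : 0 ≤ α)
    (z : ℝ → ℝ) (hz : ContinuousOn z (Set.Ici (0 : ℝ)))
    (p : ℝ → ℝ) (p₀ : ℝ) (hp₀ : p₀ ∈ Set.Ioo (0 : ℝ) 1) (hp0 : p 0 = p₀)
    (hp : ∀ t ∈ Set.Ici (0 : ℝ),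
      HasDerivWithinAt p ((r + α * z t) * p t * (1 - p t)) (Set.Ici (0 : ℝ)) t) :
    (∀ t ∈ Set.Ici (0 : ℝ), p t ∈ Set.Ioo (0 : ℝ) 1) ∧
    (∀ t > (0 : ℝ),
      (1 / t) * Real.log (p t * (1 - p₀) / (p₀ * (1 - p t)))
        = r + (α / t) * ∫ s in (0 : ℝ)..t, z s) ∧
    (Tendsto (fun t => (1 / t) * ∫ s in (0 : ℝ)..t, z s) atTop (nhds 0) →
      Tendsto (fun t => (1 / t) * Real.log (p t * (1 - p₀) / (p₀ * (1 - p t))))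
        atTop (nhds r)) := by
  obtain ⟨h0, h1⟩ := hp₀
  have hpc : ContinuousOn p (Set.Ici (0 : ℝ)) := fun t ht => (hp t ht).continuousWithinAt
  have hac : ContinuousOn (fun t => (r + α * z t) * (1 - p t)) (Set.Ici (0 : ℝ)) := by fun_prop
  have hbc : ContinuousOn (fun t => -((r + α * z t) * p t)) (Set.Ici (0 : ℝ)) := by fun_prop
  have hA := linear_ode_solution _ p hac (fun t ht => (hp t ht).congr_deriv (by ring))
  have hB := linear_ode_solution _ (fun t => 1 - p t) hbc
    (fun t ht => ((hp t ht).const_sub 1).congr_deriv (by ring))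
  simp only [hp0] at hA hB
  have key : ∀ t > (0 : ℝ),
      (1 / t) * Real.log (p t * (1 - p₀) / (p₀ * (1 - p t)))
        = r + (α / t) * ∫ s in (0 : ℝ)..t, z s := by
    intro t ht
    have hsub : Set.uIcc 0 t ⊆ Set.Ici (0 : ℝ) := by
      rw [Set.uIcc_of_le ht.le]; exact Set.Icc_subset_Ici_self
    have hdiff : (∫ s in (0 : ℝ)..t, (r + α * z s) * (1 - p s))
        - (∫ s in (0 : ℝ)..t, -((r + α * z s) * p s)) = t * r + α * ∫ s in (0 : ℝ)..t, z s := by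
      rw [← integral_sub (hac.mono hsub).intervalIntegrable (hbc.mono hsub).intervalIntegrable]
      have : ∀ s, (r + α * z s) * (1 - p s) - -((r + α * z s) * p s) = r + α * z s :=
        fun s => by ring
      simp only [this]
      rw [integral_add (by simp) ((hz.mono hsub).intervalIntegrable.const_mul α)]
      simp
    have h1' : (1 - p₀) ≠ 0 := by linarith
    have hq : p t * (1 - p₀) / (p₀ * (1 - p t))
        = Real.exp (t * r + α * ∫ s in (0 : ℝ)..t, z s) := by
      rw [← hdiff, Real.exp_sub, hB t ht.le, hA t ht.le]
      have := h0.ne'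
      field_simp
    rw [hq, Real.log_exp]
    field_simp
  refine ⟨fun t ht => ⟨?_, ?_⟩, key, fun hlim => ?_⟩
  · rw [hA t ht]; positivity
  · have h := hB t ht
    have h2 : 0 < 1 - p t := by
      rw [h]; exact mul_pos (by linarith) (Real.exp_pos _)
    linarith
  · have h := (hlim.const_mul α).const_add r
    simp only [mul_zero, add_zero] at h
    refine h.congr' ?_
    filter_upwards [eventually_gt_atTop 0] with t ht
    rw [key t ht]
    ring
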